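/- The explicit connection ∇^L on the BCV space N is torsion-free and compatible with g_L: for all smooth vector fields V, W, Z on N and every x ∈ N, (∇^L_V W)(x) − (∇^L_W V)(x) = [V,W](x), and the derivative of the function y ↦ g_L(y)(W(y),Z(y)) at x in the direction V(x) equals g_L(x)((∇^L_V W)(x), Z(x)) + g_L(x)(W(x), (∇^L_V Z)(x)). Hence ∇^L is the Levi-Civita connection of (N, g_L). -/

import Mathlib

/- Common setup for the BCV spaces (twisted BCV paper formalization). -/

noncomputable section

open scoped BigOperators

/-- A point of `ℝ³`. -/
abbrev Pt : Type := Fin 3 → ℝ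

/-- A vector field on (an open subset of) `ℝ³`, viewed as a map `ℝ³ → ℝ³`. -/
abbrev VF : Type := Pt → Pt

/-- `μ(x) = 1 + (λ/4)(x₁² + x₂²)`. -/
def mu (lam : ℝ) (x : Pt) : ℝ := 1 + lam / 4 * ((x 0) ^ 2 + (x 1) ^ 2)

/-- The frame field `X₁`. -/
def X1 (lam tau : ℝ) : VF := fun x => ![mu lam x, 0, -tau * x 1]

/-- The frame field `X₂`. -/
def X2 (lam tau : ℝ) : VF := fun x => ![0, mu lam x, tau * x 0]

/-- The frame field `X₃`. -/
def X3 : VF := fun _ => ![0, 0, 1]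

/-- The frame as a family indexed by `Fin 3`. -/
def Xf (lam tau : ℝ) : Fin 3 → VF := ![X1 lam tau, X2 lam tau, X3]

/-- Lie bracket of vector fields: `[V,W](x) = DW(x)(V(x)) − DV(x)(W(x))`. -/
def bracket (V W : VF) (x : Pt) : Pt := fderiv ℝ W x (V x) - fderiv ℝ V x (W x)

/-- The coframe `ω₁, ω₂, ω₃` evaluated at `x` on the tangent vector `v`. -/
def omf (lam tau : ℝ) (i : Fin 3) (x v : Pt) : ℝ :=
  ![v 0 / mu lam x, v 1 / mu lam x,
    v 2 + tau * (x 1 * v 0 - x 0 * v 1) / mu lam x] i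

/-- The metric `g_L(x)(v,w) = ω₁(v)ω₁(w) + ω₂(v)ω₂(w) + L·ω₃(v)ω₃(w)`. -/
def gL (lam tau L : ℝ) (x v w : Pt) : ℝ :=
  omf lam tau 0 x v * omf lam tau 0 x w + omf lam tau 1 x v * omf lam tau 1 x w
    + L * (omf lam tau 2 x v * omf lam tau 2 x w)

/-- The directional derivative `X(f)(x) = Df(x)(X(x))` of `f` along the vector field `X`. -/
def dd (X : VF) (f : Pt → ℝ) (x : Pt) : ℝ := fderiv ℝ f x (X x)

/-- The connection table `(∇^L_{Xᵢ}Xⱼ)(x)` on the frame. -/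
def nablaF (lam tau L : ℝ) (i j : Fin 3) (x : Pt) : Pt :=
  ![![(lam / 2 * x 1) • X2 lam tau x,
      (-(lam / 2) * x 1) • X1 lam tau x + tau • X3 x,
      (-(tau * L)) • X2 lam tau x],
    ![(-(lam / 2) * x 0) • X2 lam tau x - tau • X3 x,
      (lam / 2 * x 0) • X1 lam tau x,
      (tau * L) • X1 lam tau x],
    ![(-(tau * L)) • X2 lam tau x,
      (tau * L) • X1 lam tau x,
      (0 : Pt)]] i j

/-- The connection `∇^L` extended to general vector fields `V = Σᵢ vᵢXᵢ`, `W = Σⱼ wⱼXⱼ`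
(with `vᵢ = ωᵢ(V)`, `wⱼ = ωⱼ(W)`):
`∇^L_V W = Σᵢⱼ vᵢ·(Xᵢ(wⱼ)·Xⱼ + wⱼ·∇^L_{Xᵢ}Xⱼ)`. -/
def nabla (lam tau L : ℝ) (V W : VF) (x : Pt) : Pt :=
  ∑ i : Fin 3, ∑ j : Fin 3,
    omf lam tau i x (V x) •
      (dd (Xf lam tau i) (fun y => omf lam tau j y (W y)) x • Xf lam tau j x
        + omf lam tau j x (W x) • nablaF lam tau L i j x)

/-- The curvature `R^L(V,W)Z = ∇^L_V∇^L_W Z − ∇^L_W∇^L_V Z − ∇^L_{[V,W]}Z`. -/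
def RL (lam tau L : ℝ) (V W Z : VF) (x : Pt) : Pt :=
  nabla lam tau L V (nabla lam tau L W Z) x - nabla lam tau L W (nabla lam tau L V Z) x
    - nabla lam tau L (bracket V W) Z x

/-- `p = X₁u`. -/
def pf (lam tau : ℝ) (u : Pt → ℝ) (x : Pt) : ℝ := dd (X1 lam tau) u x

/-- `q = X₂u`. -/
def qf (lam tau : ℝ) (u : Pt → ℝ) (x : Pt) : ℝ := dd (X2 lam tau) u x

/-- `X₃u`. -/
def X3u (u : Pt → ℝ) (x : Pt) : ℝ := dd X3 u x

/-- `l = √(p² + q²)`. -/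
def lf (lam tau : ℝ) (u : Pt → ℝ) (x : Pt) : ℝ :=
  Real.sqrt (pf lam tau u x ^ 2 + qf lam tau u x ^ 2)

/-- `X̃₃ = L^{-1/2} X₃`. -/
def X3t (L : ℝ) : VF := fun x => (Real.sqrt L)⁻¹ • X3 x

/-- `r = X̃₃u = L^{-1/2} X₃u`. -/
def rf (L : ℝ) (u : Pt → ℝ) (x : Pt) : ℝ := (Real.sqrt L)⁻¹ * X3u u x

/-- `l_L = √(p² + q² + r²)`. -/
def lL (lam tau L : ℝ) (u : Pt → ℝ) (x : Pt) : ℝ :=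
  Real.sqrt (pf lam tau u x ^ 2 + qf lam tau u x ^ 2 + rf L u x ^ 2)

/-- `p̄ = p/l`. -/
def pbar (lam tau : ℝ) (u : Pt → ℝ) (x : Pt) : ℝ := pf lam tau u x / lf lam tau u x

/-- `q̄ = q/l`. -/
def qbar (lam tau : ℝ) (u : Pt → ℝ) (x : Pt) : ℝ := qf lam tau u x / lf lam tau u x

/-- `p̄_L = p/l_L`. -/
def pbarL (lam tau L : ℝ) (u : Pt → ℝ) (x : Pt) : ℝ := pf lam tau u x / lL lam tau L u x

/-- `q̄_L = q/l_L`. -/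
def qbarL (lam tau L : ℝ) (u : Pt → ℝ) (x : Pt) : ℝ := qf lam tau u x / lL lam tau L u x

/-- `r̄_L = r/l_L`. -/
def rbarL (lam tau L : ℝ) (u : Pt → ℝ) (x : Pt) : ℝ := rf L u x / lL lam tau L u x

/-- The Riemannian unit normal `ν_L = p̄_L X₁ + q̄_L X₂ + r̄_L X̃₃`. -/
def nuL (lam tau L : ℝ) (u : Pt → ℝ) : VF := fun x =>
  pbarL lam tau L u x • X1 lam tau x + qbarL lam tau L u x • X2 lam tau x
    + rbarL lam tau L u x • X3t L x

/-- The tangent frame field `ē₁ = q̄X₁ − p̄X₂`. -/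
def e1 (lam tau : ℝ) (u : Pt → ℝ) : VF := fun x =>
  qbar lam tau u x • X1 lam tau x - pbar lam tau u x • X2 lam tau x

/-- The tangent frame field `ē₂ = r̄_L p̄ X₁ + r̄_L q̄ X₂ − (l/l_L)X̃₃`. -/
def e2 (lam tau L : ℝ) (u : Pt → ℝ) : VF := fun x =>
  (rbarL lam tau L u x * pbar lam tau u x) • X1 lam tau x
    + (rbarL lam tau L u x * qbar lam tau u x) • X2 lam tau x
    - (lf lam tau u x / lL lam tau L u x) • X3t L x

theorem frame_expand (lam tau : ℝ) (x v : Pt) (hx : 0 < mu lam x) :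
    ∑ i : Fin 3, omf lam tau i x v • Xf lam tau i x = v := by
  have hm : mu lam x ≠ 0 := hx.ne'
  ext k
  fin_cases k <;> simp [Fin.sum_univ_three, omf, Xf, X1, X2, X3] <;> field_simp <;> ring

theorem nabla_eq (lam tau L : ℝ) (V W : VF) (x : Pt) (hx : 0 < mu lam x) :
    nabla lam tau L V W x =
      (∑ j : Fin 3, fderiv ℝ (fun y => omf lam tau j y (W y)) x (V x) • Xf lam tau j x)
      + ∑ i : Fin 3, ∑ j : Fin 3,
        (omf lam tau i x (V x) * omf lam tau j x (W x)) • nablaF lam tau L i j x := by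
  have h : ∀ j, fderiv ℝ (fun y => omf lam tau j y (W y)) x (V x) =
      ∑ i : Fin 3, omf lam tau i x (V x) *
        fderiv ℝ (fun y => omf lam tau j y (W y)) x (Xf lam tau i x) := by
    intro j
    conv_lhs => rw [← frame_expand lam tau x (V x) hx]
    rw [map_sum]
    simp only [map_smul, smul_eq_mul]
  simp only [h, nabla, dd, Finset.sum_smul, smul_add, Finset.sum_add_distrib, smul_smul]
  rw [Finset.sum_comm]

theorem coord_hasFDerivAt (W : VF) (x : Pt) (hW : DifferentiableAt ℝ W x) (k : Fin 3) :
    HasFDerivAt (fun y => W y k)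
      ((ContinuousLinearMap.proj (R := ℝ) (φ := fun _ : Fin 3 => ℝ) k).comp (fderiv ℝ W x)) x :=
  (hasFDerivAt_pi'.1 hW.hasFDerivAt) k

theorem mu_hasFDerivAt (lam : ℝ) (x : Pt) :
    HasFDerivAt (mu lam)
      ((lam / 2 * x 0) • (ContinuousLinearMap.proj (R := ℝ) (φ := fun _ : Fin 3 => ℝ) 0)
       + (lam / 2 * x 1) • (ContinuousLinearMap.proj (R := ℝ) (φ := fun _ : Fin 3 => ℝ) 1)) x := by
  have h0 : HasFDerivAt (fun y : Pt => y 0) _ x :=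
    (ContinuousLinearMap.proj (R := ℝ) (φ := fun _ : Fin 3 => ℝ) 0).hasFDerivAt
  have h1 : HasFDerivAt (fun y : Pt => y 1) _ x :=
    (ContinuousLinearMap.proj (R := ℝ) (φ := fun _ : Fin 3 => ℝ) 1).hasFDerivAt
  have h := (((h0.mul h0).add (h1.mul h1)).const_mul (lam / 4)).const_add 1
  refine (h.congr_fderiv ?_).congr_of_eventuallyEq (Filter.Eventually.of_forall fun y => ?_)
  · ext v
    simp
    ring
  · simp only [mu, Pi.add_apply, Pi.mul_apply]
    ring

/-- Quotient by `mu`. -/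
theorem div_mu_hasFDerivAt (lam : ℝ) (x : Pt) (hx : 0 < mu lam x) (f : Pt → ℝ)
    (fd : Pt →L[ℝ] ℝ) (hf : HasFDerivAt f fd x) :
    ∃ D : Pt →L[ℝ] ℝ, HasFDerivAt (fun y => f y / mu lam y) D x ∧
      ∀ v, D v = (fd v * mu lam x - f x * (lam / 2 * (x 0 * v 0 + x 1 * v 1))) / mu lam x ^ 2 := by
  have hm : mu lam x ≠ 0 := hx.ne'
  have hi := (hasDerivAt_inv hm).comp_hasFDerivAt x (mu_hasFDerivAt lam x)
  have h := hf.mul hi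
  refine ⟨_, h.congr_of_eventuallyEq (Filter.Eventually.of_forall fun y => ?_), fun v => ?_⟩
  · simp [div_eq_mul_inv]
  · simp
    field_simp
    ring

theorem omf_hasFDerivAt (lam tau : ℝ) (W : VF) (x : Pt) (hW : DifferentiableAt ℝ W x)
    (hx : 0 < mu lam x) (j : Fin 3) :
    ∃ D : Pt →L[ℝ] ℝ, HasFDerivAt (fun y => omf lam tau j y (W y)) D x ∧
      ∀ v, D v = ![(fderiv ℝ W x v 0 * mu lam x
              - W x 0 * (lam / 2 * (x 0 * v 0 + x 1 * v 1))) / mu lam x ^ 2,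
            (fderiv ℝ W x v 1 * mu lam x
              - W x 1 * (lam / 2 * (x 0 * v 0 + x 1 * v 1))) / mu lam x ^ 2,
            fderiv ℝ W x v 2 + (tau * (v 1 * W x 0 + x 1 * fderiv ℝ W x v 0
                - v 0 * W x 1 - x 0 * fderiv ℝ W x v 1) * mu lam x
              - tau * (x 1 * W x 0 - x 0 * W x 1) * (lam / 2 * (x 0 * v 0 + x 1 * v 1)))
                / mu lam x ^ 2] j := by
  have h0 : HasFDerivAt (fun y : Pt => y 0) _ x :=
    (ContinuousLinearMap.proj (R := ℝ) (φ := fun _ : Fin 3 => ℝ) 0).hasFDerivAt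
  have h1 : HasFDerivAt (fun y : Pt => y 1) _ x :=
    (ContinuousLinearMap.proj (R := ℝ) (φ := fun _ : Fin 3 => ℝ) 1).hasFDerivAt
  have w := coord_hasFDerivAt W x hW
  fin_cases j
  · obtain ⟨D, hD, hv⟩ := div_mu_hasFDerivAt lam x hx _ _ (w 0)
    exact ⟨D, hD, fun v => by rw [hv]; simp⟩
  · obtain ⟨D, hD, hv⟩ := div_mu_hasFDerivAt lam x hx _ _ (w 1)
    exact ⟨D, hD, fun v => by rw [hv]; simp⟩
  · obtain ⟨D, hD, hv⟩ := div_mu_hasFDerivAt lam x hx _ _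
      (((h1.fun_mul (w 0)).fun_sub (h0.fun_mul (w 1))).const_mul tau)
    refine ⟨_, (w 2).fun_add hD, fun v => ?_⟩
    rw [add_apply, hv]
    simp
    ring

theorem omf_lin (lam tau : ℝ) (x : Pt) (hx : 0 < mu lam x) (c : Fin 3 → ℝ) (i : Fin 3) :
    omf lam tau i x (∑ j : Fin 3, c j • Xf lam tau j x) = c i := by
  have hm : mu lam x ≠ 0 := hx.ne'
  fin_cases i <;> simp [Fin.sum_univ_three, omf, Xf, X1, X2, X3] <;> field_simp <;> ring

/-- Frame coefficients of `nabla`. -/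
theorem nabla_coeff (lam tau L : ℝ) (V W : VF) (x : Pt) (hx : 0 < mu lam x) (v w d : Fin 3 → ℝ)
    (hv : ∀ i, omf lam tau i x (V x) = v i) (hw : ∀ i, omf lam tau i x (W x) = w i)
    (hd : ∀ i, fderiv ℝ (fun y => omf lam tau i y (W y)) x (V x) = d i) :
    nabla lam tau L V W x = ∑ j : Fin 3,
      (![d 0 - lam / 2 * x 1 * (v 0 * w 1) + lam / 2 * x 0 * (v 1 * w 1)
          + tau * L * (v 1 * w 2 + v 2 * w 1),
        d 1 + lam / 2 * x 1 * (v 0 * w 0) - lam / 2 * x 0 * (v 1 * w 0)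
          - tau * L * (v 0 * w 2 + v 2 * w 0),
        d 2 + tau * (v 0 * w 1 - v 1 * w 0)] : Fin 3 → ℝ) j • Xf lam tau j x := by
  rw [nabla_eq lam tau L V W x hx]
  simp only [hv, hw, hd]
  ext k
  fin_cases k <;> simp [Fin.sum_univ_three, nablaF, Xf, X1, X2, X3] <;> ring

/-- the explicit connection `∇^L` is torsion-free and metric-compatible
on `N`, hence is the Levi-Civita connection of `(N, g_L)`. -/
theorem statement3 (lam tau : ℝ) (htau : 0 < tau) (L : ℝ) (hL : 0 < L) (V W Z : VF)
    (hV : ContDiffOn ℝ (⊤ : ℕ∞) V {y : Pt | 0 < mu lam y})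
    (hW : ContDiffOn ℝ (⊤ : ℕ∞) W {y : Pt | 0 < mu lam y})
    (hZ : ContDiffOn ℝ (⊤ : ℕ∞) Z {y : Pt | 0 < mu lam y})
    (x : Pt) (hx : 0 < mu lam x) :
    nabla lam tau L V W x - nabla lam tau L W V x = bracket V W x ∧
    fderiv ℝ (fun y => gL lam tau L y (W y) (Z y)) x (V x) =
      gL lam tau L x (nabla lam tau L V W x) (Z x)
        + gL lam tau L x (W x) (nabla lam tau L V Z x) := by
  have hopen : IsOpen {y : Pt | 0 < mu lam y} := by
    refine isOpen_lt continuous_const ?_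
    unfold mu
    fun_prop
  have key : ∀ U : VF, ContDiffOn ℝ (⊤ : ℕ∞) U {y : Pt | 0 < mu lam y} →
      DifferentiableAt ℝ U x := fun U hU =>
    (hU.contDiffAt (hopen.mem_nhds hx)).differentiableAt (by simp)
  have dV := key V hV
  have dW := key W hW
  have dZ := key Z hZ
  constructor
  · have fW : ∀ j, _ := fun j => omf_hasFDerivAt lam tau W x dW hx j
    have fV : ∀ j, _ := fun j => omf_hasFDerivAt lam tau V x dV hx j
    choose DW hDW eDW using fW
    choose DV hDV eDV using fV
    rw [nabla_coeff lam tau L V W x hx _ _ _ (fun _ => rfl) (fun _ => rfl) (fun i => by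
        rw [(hDW i).fderiv, eDW i]),
      nabla_coeff lam tau L W V x hx _ _ _ (fun _ => rfl) (fun _ => rfl) (fun i => by
        rw [(hDV i).fderiv, eDV i])]
    have hm : mu lam x ≠ 0 := hx.ne'
    have hme : mu lam x = 1 + lam / 4 * ((x 0) ^ 2 + (x 1) ^ 2) := rfl
    unfold bracket
    generalize fderiv ℝ W x (V x) = a
    generalize fderiv ℝ V x (W x) = b
    generalize V x = v
    generalize W x = w
    ext k
    fin_cases k
    · simp [Fin.sum_univ_three, omf, Xf, X1, X2, X3]
      generalize mu lam x = m at hm hme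
      field_simp
      ring
    · simp [Fin.sum_univ_three, omf, Xf, X1, X2, X3]
      generalize mu lam x = m at hm hme
      field_simp
      ring
    · simp [Fin.sum_univ_three, omf, Xf, X1, X2, X3]
      generalize mu lam x = m at hm hme
      field_simp
      linear_combination 4 * tau * (w 0 * v 1 - v 0 * w 1) * hme
  · have fW : ∀ j, HasFDerivAt (fun y => omf lam tau j y (W y))
        (fderiv ℝ (fun y => omf lam tau j y (W y)) x) x := fun j => by
      obtain ⟨D, hD, -⟩ := omf_hasFDerivAt lam tau W x dW hx j
      exact hD.differentiableAt.hasFDerivAt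
    have fZ : ∀ j, HasFDerivAt (fun y => omf lam tau j y (Z y))
        (fderiv ℝ (fun y => omf lam tau j y (Z y)) x) x := fun j => by
      obtain ⟨D, hD, -⟩ := omf_hasFDerivAt lam tau Z x dZ hx j
      exact hD.differentiableAt.hasFDerivAt
    have h : HasFDerivAt (fun y => gL lam tau L y (W y) (Z y)) _ x :=
      (((fW 0).fun_mul (fZ 0)).fun_add ((fW 1).fun_mul (fZ 1))).fun_add
        (((fW 2).fun_mul (fZ 2)).const_mul L)
    rw [h.fderiv, nabla_coeff lam tau L V W x hx _ _ _ (fun _ => rfl) (fun _ => rfl) (fun _ => rfl),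
      nabla_coeff lam tau L V Z x hx _ _ _ (fun _ => rfl) (fun _ => rfl) (fun _ => rfl)]
    unfold gL
    simp only [omf_lin lam tau x hx]
    simp
    ring
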